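/- arXiv:1610.03136 — 2 statements merged into one kernel-verified Lean document; each statement's English description precedes it below -/
import Mathlib

section
/- Let R be a unital commutative ring with 1/6 ∈ R, A an associative R-algebra, and let k > 0 and m_1, ..., m_k be odd positive integers. Then T^(m_1)(A) · ... · T^(m_k)(A) ⊆ T^(N_k)(A), where N_k = m_1 + ... + m_k - k + 1. -/
open scoped TensorProduct

/-- Left-normed commutator: `lc a [b₁,...,bₙ] = [a, b₁, ..., bₙ]`. -/
def lc {A : Type*} [Ring A] : A → List A → A
  | a, [] => a
  | a, b :: l => lc ⁅a, b⁆ l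

/-- Left-normed commutator of a list; `lcomm [a₁,...,aₙ] = [a₁,...,aₙ]`, `lcomm [] = 0`. -/
def lcomm {A : Type*} [Ring A] : List A → A
  | [] => 0
  | a :: l => lc a l

/-- `Tideal A n` = two-sided ideal of `A` generated by all left-normed commutators of length `n`. -/
def Tideal (A : Type*) [Ring A] (n : ℕ) : TwoSidedIdeal A :=
  TwoSidedIdeal.span {x | ∃ l : List A, l.length = n ∧ x = lcomm l}

section LowerCentralSeries

variable (R A : Type*) [CommRing R] [Ring A] [Algebra R A]

/-- The lower central series of `A` as a Lie algebra, starting with `lcs R A 0 = A`. -/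
def lcs : ℕ → Submodule R A
  | 0 => ⊤
  | n + 1 => Submodule.span R {x | ∃ y ∈ lcs n, ∃ a : A, x = ⁅y, a⁆}

/-- The left ideal generated by `lcs R A n`; it is in fact two-sided. -/
def lcsIdeal (n : ℕ) : Submodule R A :=
  Submodule.span R {x | ∃ a : A, ∃ y ∈ lcs R A n, x = a * y}

variable {R A}

variable (R) in
/-- The linear map `y ↦ ⁅y, z⁆`. -/
def lieRight (z : A) : A →ₗ[R] A := LinearMap.mulRight R z - LinearMap.mulLeft R z

variable (R) in
/-- The linear map `y ↦ ⁅x, y⁆`. -/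
def lieLeft (x : A) : A →ₗ[R] A := LinearMap.mulLeft R x - LinearMap.mulRight R x

theorem lieLeft_apply (x y : A) : lieLeft R x y = ⁅x, y⁆ := by
  simp [lieLeft, Ring.lie_def]

theorem lieRight_apply (z y : A) : lieRight R z y = ⁅y, z⁆ := by
  simp [lieRight, Ring.lie_def]

theorem neg_lie_swap (x y : A) : -⁅y, x⁆ = ⁅x, y⁆ := by
  simp [Ring.lie_def]

theorem mem_lcs_zero (a : A) : a ∈ lcs R A 0 := Submodule.mem_top

theorem lcs_cast {i j : ℕ} (h : i = j) {x : A} (hx : x ∈ lcs R A i) : x ∈ lcs R A j := h ▸ hx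

/-- A linear condition holds on `lcs R A (n + 1)` if it holds on its generators. -/
theorem lcs_succ_le {n : ℕ} {p : Submodule R A}
    (h : ∀ y ∈ lcs R A n, ∀ a : A, ⁅y, a⁆ ∈ p) : lcs R A (n + 1) ≤ p :=
  Submodule.span_le.2 (by rintro _ ⟨y, hy, a, rfl⟩; exact h y hy a)

theorem lcsIdeal_le {n : ℕ} {p : Submodule R A}
    (h : ∀ a : A, ∀ y ∈ lcs R A n, a * y ∈ p) : lcsIdeal R A n ≤ p :=
  Submodule.span_le.2 (by rintro _ ⟨a, y, hy, rfl⟩; exact h a y hy)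

theorem lie_mem_succ {n : ℕ} {x : A} (hx : x ∈ lcs R A n) (a : A) :
    ⁅x, a⁆ ∈ lcs R A (n + 1) :=
  Submodule.subset_span ⟨x, hx, a, rfl⟩

theorem lie_mem {i j : ℕ} {x y : A} (hx : x ∈ lcs R A i) (hy : y ∈ lcs R A j) :
    ⁅x, y⁆ ∈ lcs R A (i + j + 1) := by
  induction j generalizing i x y with
  | zero => exact Submodule.subset_span ⟨x, hx, y, rfl⟩
  | succ j ih =>
    suffices h : lcs R A (j + 1) ≤
        (lcs R A (i + (j + 1) + 1)).comap (lieLeft R x) by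
      simpa only [Submodule.mem_comap, lieLeft_apply] using h hy
    refine lcs_succ_le fun z hz a => ?_
    have e : ⁅x, ⁅z, a⁆⁆ = ⁅⁅x, z⁆, a⁆ - ⁅⁅x, a⁆, z⁆ := by
      simp only [Ring.lie_def]; noncomm_ring
    rw [Submodule.mem_comap, lieLeft_apply, e]
    exact sub_mem (lcs_cast (by omega) (lie_mem_succ (ih hx hz) a))
      (lcs_cast (by omega) (ih (lie_mem_succ hx a) hz))

theorem lcs_succ_le_lcs (n : ℕ) : lcs R A (n + 1) ≤ lcs R A n := by
  induction n with
  | zero => exact le_top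
  | succ n ih =>
    exact lcs_succ_le fun y hy a => Submodule.subset_span ⟨y, ih hy, a, rfl⟩

theorem mul_mem_lcsIdeal {n : ℕ} (a : A) {y : A} (hy : y ∈ lcs R A n) :
    a * y ∈ lcsIdeal R A n :=
  Submodule.subset_span ⟨a, y, hy, rfl⟩

theorem lcs_le_lcsIdeal (n : ℕ) : lcs R A n ≤ lcsIdeal R A n := fun y hy => by
  simpa using mul_mem_lcsIdeal (1 : A) hy

theorem lcsIdeal_mul_mem_left {n : ℕ} (b : A) {u : A} (hu : u ∈ lcsIdeal R A n) :
    b * u ∈ lcsIdeal R A n := by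
  suffices h : lcsIdeal R A n ≤ (lcsIdeal R A n).comap (LinearMap.mulLeft R b) from h hu
  refine lcsIdeal_le fun a y hy => ?_
  simpa [← mul_assoc] using mul_mem_lcsIdeal (b * a) hy

theorem lcsIdeal_mul_mem_right {n : ℕ} (b : A) {u : A} (hu : u ∈ lcsIdeal R A n) :
    u * b ∈ lcsIdeal R A n := by
  suffices h : lcsIdeal R A n ≤ (lcsIdeal R A n).comap (LinearMap.mulRight R b) from h hu
  refine lcsIdeal_le fun a y hy => ?_
  have e : a * y * b = a * b * y + a * ⁅y, b⁆ := by
    simp only [Ring.lie_def]; noncomm_ring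
  rw [Submodule.mem_comap, LinearMap.mulRight_apply, e]
  exact add_mem (mul_mem_lcsIdeal _ hy)
    (mul_mem_lcsIdeal _ (lcs_succ_le_lcs n (lie_mem_succ hy b)))

/-- The identity expressing `3 • [a[l, c, d], e]` through Lie monomials of length four. -/
theorem three_nsmul_lie_mul_lie_lie (a l c d e : A) :
    3 • ⁅a * ⁅⁅l, c⁆, d⁆, e⁆ =
      ⁅⁅⁅c * l, d⁆, a⁆, e⁆
      + ⁅⁅⁅l, a⁆, e * c⁆, d⁆
      + ⁅⁅⁅a * l, e⁆, c⁆, d⁆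
      + ⁅⁅l, e⁆, ⁅c * a, d⁆⁆
      + ⁅⁅l * d, e⁆, ⁅a, c⁆⁆
      + ⁅⁅l * c, a⁆, ⁅d, e⁆⁆
      + 2 • ⁅⁅⁅l * a, e⁆, d⁆, c⁆
      + 2 • ⁅⁅⁅l * d, a⁆, e⁆, c⁆
      + 2 • ⁅⁅a * l, c⁆, ⁅d, e⁆⁆
      + 2 • ⁅⁅⁅l, c⁆, d⁆, e * a⁆
      + 2 • ⁅⁅⁅l, e⁆, d * c⁆, a⁆
      + 2 • ⁅⁅⁅l, d * e⁆, a⁆, c⁆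
      - ⁅⁅⁅l * c, d⁆, e⁆, a⁆
      - ⁅⁅⁅l, a * e⁆, c⁆, d⁆
      - ⁅⁅⁅a, c * e⁆, l⁆, d⁆
      - ⁅⁅⁅c, e⁆, l⁆, a * d⁆
      - ⁅⁅⁅a, d * l⁆, c⁆, e⁆
      - ⁅⁅⁅l, c⁆, d * e⁆, a⁆
      - ⁅⁅⁅l, a⁆, c⁆, e * d⁆
      - ⁅⁅⁅d, e⁆, c * a⁆, l⁆
      - ⁅⁅⁅l, d⁆, a * e⁆, c⁆
      - ⁅⁅⁅l, d⁆, a⁆, e * c⁆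
      - ⁅⁅c, e * l⁆, ⁅a, d⁆⁆
      - 2 • ⁅⁅⁅l, a⁆, e⁆, d * c⁆
      - 3 • ⁅⁅⁅l * d, e⁆, a⁆, c⁆ := by
  simp only [Ring.lie_def, mul_sub, sub_mul, mul_assoc]
  abel

theorem lie_mul_lie_lie_mem (h3 : IsUnit (3 : R)) {j : ℕ} {l : A} (hl : l ∈ lcs R A j)
    (hq : ∀ a e : A, ⁅a * l, e⁆ ∈ lcs R A (j + 1)) (a c d e : A) :
    ⁅a * ⁅⁅l, c⁆, d⁆, e⁆ ∈ lcs R A (j + 3) := by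
  have ht : ∀ b : A, b ∈ lcs R A 0 := mem_lcs_zero
  have hp : ∀ b f : A, ⁅l * b, f⁆ ∈ lcs R A (j + 1) := fun b f => by
    have h : ⁅l * b, f⁆ = ⁅b * l, f⁆ + ⁅⁅l, b⁆, f⁆ := by
      simp only [Ring.lie_def]; noncomm_ring
    rw [h]
    exact add_mem (hq b f) (lcs_succ_le_lcs _ (lie_mem_succ (lie_mem_succ hl b) f))
  have hr : ∀ f b : A, ⁅f, b * l⁆ ∈ lcs R A (j + 1) := fun f b => by
    rw [← neg_lie_swap]; exact neg_mem (hq b f)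
  suffices h : 3 • ⁅a * ⁅⁅l, c⁆, d⁆, e⁆ ∈ lcs R A (j + 3) by
    obtain ⟨u, hu⟩ := h3
    have h' := (lcs R A (j + 3)).smul_mem (↑u⁻¹ : R) h
    rwa [← Nat.cast_smul_eq_nsmul R, Nat.cast_ofNat, ← hu, smul_smul, Units.inv_mul,
      one_smul] at h'
  rw [three_nsmul_lie_mul_lie_lie]
  iterate 13 refine sub_mem ?_ ?_
  iterate 11 refine add_mem ?_ ?_
  · exact lcs_cast (by omega) (lie_mem (lie_mem (hq _ _) (ht _)) (ht _))
  · exact lcs_cast (by omega) (lie_mem (lie_mem (lie_mem hl (ht _)) (ht _)) (ht _))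
  · exact lcs_cast (by omega) (lie_mem (lie_mem (hq _ _) (ht _)) (ht _))
  · exact lcs_cast (by omega) (lie_mem (lie_mem hl (ht _)) (lie_mem (ht _) (ht _)))
  · exact lcs_cast (by omega) (lie_mem (hp _ _) (lie_mem (ht _) (ht _)))
  · exact lcs_cast (by omega) (lie_mem (hp _ _) (lie_mem (ht _) (ht _)))
  · exact nsmul_mem (lcs_cast (by omega) (lie_mem (lie_mem (hp _ _) (ht _)) (ht _))) 2
  · exact nsmul_mem (lcs_cast (by omega) (lie_mem (lie_mem (hp _ _) (ht _)) (ht _))) 2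
  · exact nsmul_mem (lcs_cast (by omega) (lie_mem (hq _ _) (lie_mem (ht _) (ht _)))) 2
  · exact nsmul_mem (lcs_cast (by omega) (lie_mem (lie_mem (lie_mem hl (ht _)) (ht _)) (ht _))) 2
  · exact nsmul_mem (lcs_cast (by omega) (lie_mem (lie_mem (lie_mem hl (ht _)) (ht _)) (ht _))) 2
  · exact nsmul_mem (lcs_cast (by omega) (lie_mem (lie_mem (lie_mem hl (ht _)) (ht _)) (ht _))) 2
  · exact lcs_cast (by omega) (lie_mem (lie_mem (hp _ _) (ht _)) (ht _))
  · exact lcs_cast (by omega) (lie_mem (lie_mem (lie_mem hl (ht _)) (ht _)) (ht _))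
  · exact lcs_cast (by omega) (lie_mem (lie_mem (lie_mem (ht _) (ht _)) hl) (ht _))
  · exact lcs_cast (by omega) (lie_mem (lie_mem (lie_mem (ht _) (ht _)) hl) (ht _))
  · exact lcs_cast (by omega) (lie_mem (lie_mem (hr _ _) (ht _)) (ht _))
  · exact lcs_cast (by omega) (lie_mem (lie_mem (lie_mem hl (ht _)) (ht _)) (ht _))
  · exact lcs_cast (by omega) (lie_mem (lie_mem (lie_mem hl (ht _)) (ht _)) (ht _))
  · exact lcs_cast (by omega) (lie_mem (lie_mem (lie_mem (ht _) (ht _)) (ht _)) hl)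
  · exact lcs_cast (by omega) (lie_mem (lie_mem (lie_mem hl (ht _)) (ht _)) (ht _))
  · exact lcs_cast (by omega) (lie_mem (lie_mem (lie_mem hl (ht _)) (ht _)) (ht _))
  · exact lcs_cast (by omega) (lie_mem (hr _ _) (lie_mem (ht _) (ht _)))
  · exact nsmul_mem (lcs_cast (by omega) (lie_mem (lie_mem (lie_mem hl (ht _)) (ht _)) (ht _))) 2
  · exact nsmul_mem (lcs_cast (by omega) (lie_mem (lie_mem (hp _ _) (ht _)) (ht _))) 3

theorem lie_mul_mem_of_even (h3 : IsUnit (3 : R)) (i : ℕ) {x : A} (hx : x ∈ lcs R A (2 * i))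
    (a e : A) : ⁅a * x, e⁆ ∈ lcs R A (2 * i + 1) := by
  induction i generalizing x a e with
  | zero => exact lie_mem_succ (mem_lcs_zero _) e
  | succ i ih =>
    have h : lcs R A (2 * i + 1 + 1) ≤
        (lcs R A (2 * i + 3)).comap (lieRight R e ∘ₗ LinearMap.mulLeft R a) := by
      refine lcs_succ_le fun z hz d => ?_
      suffices h : lcs R A (2 * i + 1) ≤ (lcs R A (2 * i + 3)).comap
          (lieRight R e ∘ₗ LinearMap.mulLeft R a ∘ₗ lieRight R d) by
        simpa only [Submodule.mem_comap, LinearMap.comp_apply, lieRight_apply] using h hz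
      refine lcs_succ_le fun l hl c => ?_
      simp only [Submodule.mem_comap, LinearMap.comp_apply, lieRight_apply,
        LinearMap.mulLeft_apply]
      exact lie_mul_lie_lie_mem h3 hl (fun a e => ih hl a e) a c d e
    refine lcs_cast (i := 2 * i + 3) (by omega) ?_
    simpa only [Submodule.mem_comap, LinearMap.comp_apply, lieRight_apply,
      LinearMap.mulLeft_apply] using h hx

theorem lie_lcsIdeal_mem_succ_of_even (h3 : IsUnit (3 : R)) {i : ℕ} (hi : Even i) {u : A}
    (hu : u ∈ lcsIdeal R A i) (z : A) : ⁅u, z⁆ ∈ lcs R A (i + 1) := by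
  obtain ⟨k, rfl⟩ := hi.two_dvd
  suffices h : lcsIdeal R A (2 * k) ≤ (lcs R A (2 * k + 1)).comap (lieRight R z) by
    simpa only [Submodule.mem_comap, lieRight_apply] using h hu
  refine lcsIdeal_le fun a y hy => ?_
  rw [Submodule.mem_comap, lieRight_apply]
  exact lie_mul_mem_of_even h3 k hy a z

theorem lie_lcsIdeal_mem_of_even (h3 : IsUnit (3 : R)) {i j : ℕ} (hi : Even i) {u z : A}
    (hu : u ∈ lcsIdeal R A i) (hz : z ∈ lcs R A j) : ⁅u, z⁆ ∈ lcs R A (i + j + 1) := by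
  induction j generalizing z with
  | zero => exact lie_lcsIdeal_mem_succ_of_even h3 hi hu z
  | succ j ih =>
    suffices h : lcs R A (j + 1) ≤
        (lcs R A (i + (j + 1) + 1)).comap (lieLeft R u) by
      simpa only [Submodule.mem_comap, lieLeft_apply] using h hz
    refine lcs_succ_le fun w hw a => ?_
    have e : ⁅u, ⁅w, a⁆⁆ = ⁅⁅u, w⁆, a⁆ + ⁅w, ⁅u, a⁆⁆ := by
      simp only [Ring.lie_def]; noncomm_ring
    rw [Submodule.mem_comap, lieLeft_apply, e]
    exact add_mem (lcs_cast (by omega) (lie_mem_succ (ih hw) a))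
      (lcs_cast (by omega) (lie_mem hw (lie_lcsIdeal_mem_succ_of_even h3 hi hu a)))

/-- The theorem of Sharma–Srivastava and Bapat–Jordan. -/
theorem mul_mem_lcsIdeal_of_even (h3 : IsUnit (3 : R)) {i j : ℕ} (hi : Even i) {u v : A}
    (hu : u ∈ lcsIdeal R A i) (hv : v ∈ lcsIdeal R A j) : u * v ∈ lcsIdeal R A (i + j) := by
  suffices h : lcsIdeal R A j ≤ (lcsIdeal R A (i + j)).comap (LinearMap.mulLeft R u) from h hv
  refine lcsIdeal_le fun b z hz => ?_
  rw [Submodule.mem_comap, LinearMap.mulLeft_apply, ← mul_assoc]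
  replace hu := lcsIdeal_mul_mem_right b hu
  generalize u * b = u at hu ⊢
  cases j with
  | zero => exact lcsIdeal_mul_mem_right z hu
  | succ j =>
    suffices h : lcs R A (j + 1) ≤
        (lcsIdeal R A (i + (j + 1))).comap (LinearMap.mulLeft R u) from h hz
    refine lcs_succ_le fun w hw c => ?_
    have e : u * ⁅w, c⁆ = ⁅u, w⁆ * c - ⁅u * c, w⁆ := by
      simp only [Ring.lie_def]; noncomm_ring
    rw [Submodule.mem_comap, LinearMap.mulLeft_apply, e]
    exact sub_mem
      (lcsIdeal_mul_mem_right c (lcs_le_lcsIdeal _ (lie_lcsIdeal_mem_of_even h3 hi hu hw)))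
      (lcs_le_lcsIdeal _ (lie_lcsIdeal_mem_of_even h3 hi (lcsIdeal_mul_mem_right c hu) hw))

theorem prod_ofFn_mem_lcsIdeal (h3 : IsUnit (3 : R)) {k : ℕ} {n : Fin k → ℕ}
    (hn : ∀ i, Even (n i)) {v : Fin k → A} (hv : ∀ i, v i ∈ lcsIdeal R A (n i)) :
    (List.ofFn v).prod ∈ lcsIdeal R A (∑ i, n i) := by
  induction k with
  | zero => simpa using lcs_le_lcsIdeal 0 (mem_lcs_zero (R := R) (1 : A))
  | succ k ih =>
    rw [List.ofFn_succ, List.prod_cons, Fin.sum_univ_succ]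
    exact mul_mem_lcsIdeal_of_even h3 (hn 0) (hv 0) (ih (fun i => hn i.succ) fun i => hv i.succ)

theorem lc_mem_lcs {n : ℕ} {x : A} (hx : x ∈ lcs R A n) (l : List A) :
    lc x l ∈ lcs R A (n + l.length) := by
  induction l generalizing n x with
  | nil => exact hx
  | cons b l ih =>
    exact lcs_cast (by simp only [List.length_cons]; omega) (ih (lie_mem_succ hx b))

theorem lc_append_singleton (x : A) (l : List A) (a : A) : lc x (l ++ [a]) = ⁅lc x l, a⁆ := by
  induction l generalizing x with
  | nil => rfl
  | cons b l ih => exact ih _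

theorem lcs_le_span_lcomm (n : ℕ) :
    lcs R A n ≤ Submodule.span R {x | ∃ l : List A, l.length = n + 1 ∧ x = lcomm l} := by
  induction n with
  | zero => exact fun x _ => Submodule.subset_span ⟨[x], rfl, rfl⟩
  | succ n ih =>
    refine lcs_succ_le fun y hy a => ?_
    rw [← lieRight_apply (R := R), ← Submodule.mem_comap]
    refine Submodule.span_le.2 ?_ (ih hy)
    rintro _ ⟨_ | ⟨b, l⟩, hl, rfl⟩
    · simp at hl
    · refine Submodule.subset_span ⟨b :: (l ++ [a]), by simpa using hl, ?_⟩
      rw [lieRight_apply]; exact (lc_append_singleton b l a).symm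

theorem Tideal_smul_mem {n : ℕ} (r : R) {x : A} (hx : x ∈ Tideal A n) : r • x ∈ Tideal A n := by
  rw [Algebra.smul_def]; exact (Tideal A n).mul_mem_left _ _ hx

theorem mem_Tideal_of_mem_lcsIdeal {n : ℕ} {x : A} (hx : x ∈ lcsIdeal R A n) :
    x ∈ Tideal A (n + 1) := by
  let T : Submodule R A :=
    { carrier := {x | x ∈ Tideal A (n + 1)}
      add_mem' := fun hx hy => (Tideal A (n + 1)).add_mem hx hy
      zero_mem' := (Tideal A (n + 1)).zero_mem
      smul_mem' := fun r _ hx => Tideal_smul_mem r hx }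
  have hT : lcs R A n ≤ T := (lcs_le_span_lcomm n).trans <|
    Submodule.span_le.2 fun y hy => TwoSidedIdeal.subset_span hy
  have h : lcsIdeal R A n ≤ T :=
    lcsIdeal_le fun a y hy => (Tideal A (n + 1)).mul_mem_left a y (hT hy)
  exact h hx

variable (R) in
theorem mem_lcsIdeal_of_mem_Tideal {n : ℕ} {x : A} (hx : x ∈ Tideal A (n + 1)) :
    x ∈ lcsIdeal R A n := by
  let I : TwoSidedIdeal A := TwoSidedIdeal.mk' (lcsIdeal R A n : Set A) (zero_mem _)
    (fun hx hy => add_mem hx hy) (fun hx => neg_mem hx)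
    (fun hy => lcsIdeal_mul_mem_left _ hy) (fun hx => lcsIdeal_mul_mem_right _ hx)
  have hI : ∀ y, y ∈ I ↔ y ∈ lcsIdeal R A n := fun y => by simp [I, TwoSidedIdeal.mem_mk']
  have h : Tideal A (n + 1) ≤ I := TwoSidedIdeal.span_le.2 <| by
    rintro _ ⟨_ | ⟨b, l⟩, hl, rfl⟩
    · simp at hl
    · refine (hI _).2 (lcs_le_lcsIdeal n ?_)
      exact lcs_cast (by simpa using hl) (lc_mem_lcs (mem_lcs_zero b) l)
  exact (hI x).1 (h hx)

end LowerCentralSeries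

/-- If `1/6 ∈ R` and all `mᵢ` are odd then
`T⁽ᵐ¹⁾(A) ⋯ T⁽ᵐᵏ⁾(A) ⊆ T⁽ᴺᵏ⁾(A)` where `Nₖ = ∑ mᵢ - k + 1`. -/
theorem statement_1 (R : Type*) [CommRing R] (h6 : IsUnit (6 : R))
    (A : Type*) [Ring A] [Algebra R A]
    (k : ℕ) (hk : 0 < k) (m : Fin k → ℕ) (hodd : ∀ i, Odd (m i)) (hpos : ∀ i, 0 < m i)
    (v : Fin k → A) (hv : ∀ i, v i ∈ Tideal A (m i)) :
    (List.ofFn v).prod ∈ Tideal A ((∑ i, m i) + 1 - k) := by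
  have h3 : IsUnit (3 : R) := isUnit_of_dvd_unit ⟨2, by norm_num⟩ h6
  have h := prod_ofFn_mem_lcsIdeal h3 (n := fun i => m i - 1)
    (fun i => (hodd i).tsub_odd odd_one)
    (fun i => mem_lcsIdeal_of_mem_Tideal R (n := m i - 1) (by
      rw [Nat.sub_add_cancel (hpos i)]; exact hv i))
  have hs : ∑ i, m i = ∑ i, (m i - 1) + k := by
    calc ∑ i, m i = ∑ i, (m i - 1 + 1) :=
          Finset.sum_congr rfl fun i _ => (Nat.sub_add_cancel (hpos i)).symm
      _ = _ := by simp [Finset.sum_add_distrib]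
  have hN : (∑ i, m i) + 1 - k = ∑ i, (m i - 1) + 1 := by omega
  rw [hN]
  exact mem_Tideal_of_mem_lcsIdeal h
end

section
/- Let R be a unital commutative ring with 1/6 ∈ R, A an associative R-algebra, and k, ℓ integers with 0 ≤ ℓ < k. Let m_1, ..., m_k ≥ 2 be integers such that ℓ of them are odd and k - ℓ > 0 of them are even. Then T^(m_1)(A) · ... · T^(m_k)(A) ⊆ T^(N_{k,ℓ})(A), where N_{k,ℓ} = (Σ_{i=1}^k m_i) - 2k + ℓ + 2. -/
open scoped TensorProduct

section LowerCentralSeries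

variable {A : Type*} [Ring A]

/-- The lower central series of `A` as a Lie ring: the additive subgroup `lowerLie A n` is spanned
by the left-normed commutators of length `n + 1`. -/
def lowerLie (A : Type*) [Ring A] : ℕ → AddSubgroup A
  | 0 => ⊤
  | n + 1 => AddSubgroup.closure {z | ∃ x ∈ lowerLie A n, ∃ y, z = ⁅x, y⁆}

/-- The left ideal generated by `lowerLie A n`. -/
def lowerIdeal (A : Type*) [Ring A] (n : ℕ) : Ideal A :=
  Ideal.span (lowerLie A n : Set A)

theorem lie_mem_lowerLie_succ {n : ℕ} {x : A} (hx : x ∈ lowerLie A n) (y : A) :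
    ⁅x, y⁆ ∈ lowerLie A (n + 1) :=
  AddSubgroup.subset_closure ⟨x, hx, y, rfl⟩

theorem mem_lowerLie_zero (x : A) : x ∈ lowerLie A 0 := AddSubgroup.mem_top x

theorem lowerLie_succ_le {n : ℕ} {B : AddSubgroup A}
    (h : ∀ x ∈ lowerLie A n, ∀ y, ⁅x, y⁆ ∈ B) : lowerLie A (n + 1) ≤ B := by
  refine (AddSubgroup.closure_le B).2 ?_
  rintro _ ⟨x, hx, y, rfl⟩
  exact h x hx y

theorem lowerLie_antitone : Antitone (lowerLie A) := by
  refine antitone_nat_of_succ_le fun n => ?_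
  induction n with
  | zero => exact le_top
  | succ n ih => exact lowerLie_succ_le fun x hx y => lie_mem_lowerLie_succ (ih hx) y

theorem lowerIdeal_antitone : Antitone (lowerIdeal A) := fun _ _ h =>
  Ideal.span_mono (lowerLie_antitone h)

theorem mem_lowerIdeal_of_mem_lowerLie {n : ℕ} {x : A} (hx : x ∈ lowerLie A n) :
    x ∈ lowerIdeal A n :=
  Ideal.subset_span hx

theorem lie_mem_lowerLie_add {n i : ℕ} {x u : A} (hx : ∀ y, ⁅x, y⁆ ∈ lowerLie A (n + 1))
    (hu : u ∈ lowerLie A i) : ⁅x, u⁆ ∈ lowerLie A (n + i + 1) := by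
  induction i generalizing n x u with
  | zero => exact hx u
  | succ i ih =>
    refine lowerLie_succ_le (B := (lowerLie A (n + (i + 1) + 1)).comap
      (AddMonoidHom.mulLeft x - AddMonoidHom.mulRight x)) ?_ hu
    intro v hv y
    change ⁅x, ⁅v, y⁆⁆ ∈ lowerLie A (n + (i + 1) + 1)
    have e : ⁅x, ⁅v, y⁆⁆ = ⁅⁅x, v⁆, y⁆ - ⁅⁅x, y⁆, v⁆ := by
      simp only [Ring.lie_def]; noncomm_ring
    rw [e]
    refine sub_mem (lie_mem_lowerLie_succ (ih hx hv) y) ?_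
    have := ih (n := n + 1) (fun z => lie_mem_lowerLie_succ (hx y) z) hv
    rwa [show n + 1 + i + 1 = n + (i + 1) + 1 by ring] at this

theorem lie_mem_lowerLie {n i : ℕ} {x u : A} (hx : x ∈ lowerLie A n) (hu : u ∈ lowerLie A i) :
    ⁅x, u⁆ ∈ lowerLie A (n + i + 1) :=
  lie_mem_lowerLie_add (lie_mem_lowerLie_succ hx) hu

theorem mul_mem_lowerIdeal_right {n : ℕ} {x : A} (hx : x ∈ lowerIdeal A n) (y : A) :
    x * y ∈ lowerIdeal A n := by
  induction hx using Submodule.span_induction with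
  | mem x hx =>
    have e : x * y = y * x + ⁅x, y⁆ := by simp only [Ring.lie_def]; noncomm_ring
    rw [e]
    exact add_mem (Ideal.mul_mem_left _ _ (mem_lowerIdeal_of_mem_lowerLie hx))
      (mem_lowerIdeal_of_mem_lowerLie
        (lowerLie_antitone (Nat.le_succ n) (lie_mem_lowerLie_succ hx y)))
  | zero => simp
  | add x z _ _ hx hz => rw [add_mul]; exact add_mem hx hz
  | smul a x _ hx => rw [smul_eq_mul, mul_assoc]; exact Ideal.mul_mem_left _ _ hx

theorem mul_mem_lowerIdeal_of_forall {p q d : ℕ}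
    (h : ∀ u ∈ lowerLie A p, ∀ w ∈ lowerLie A q, u * w ∈ lowerIdeal A d) {x y : A}
    (hx : x ∈ lowerIdeal A p) (hy : y ∈ lowerIdeal A q) : x * y ∈ lowerIdeal A d := by
  induction hx using Submodule.span_induction with
  | mem u hu =>
    induction hy using Submodule.span_induction generalizing u with
    | mem w hw => exact h u hu w hw
    | zero => simp
    | add x z _ _ hx hz => rw [mul_add]; exact add_mem (hx u hu) (hz u hu)
    | smul b w _ hw =>
      have e : u * b • w = b * (u * w) + ⁅u, b⁆ * w := by
        simp only [Ring.lie_def, smul_eq_mul]; noncomm_ring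
      rw [e]
      exact add_mem (Ideal.mul_mem_left _ _ (hw u hu))
        (hw _ (lowerLie_antitone (Nat.le_succ p) (lie_mem_lowerLie_succ hu b)))
  | zero => simp
  | add x z _ _ hx hz => rw [add_mul]; exact add_mem hx hz
  | smul a x _ hx => rw [smul_eq_mul, mul_assoc]; exact Ideal.mul_mem_left _ _ hx

theorem mul_mem_lowerIdeal_swap {p q d : ℕ} (hd : d ≤ p + q + 1) {u w : A}
    (hu : u ∈ lowerLie A p) (hw : w ∈ lowerLie A q) (h : u * w ∈ lowerIdeal A d) :
    w * u ∈ lowerIdeal A d := by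
  have e : w * u = u * w - ⁅u, w⁆ := by simp only [Ring.lie_def]; noncomm_ring
  rw [e]
  exact sub_mem h (lowerIdeal_antitone hd (mem_lowerIdeal_of_mem_lowerLie (lie_mem_lowerLie hu hw)))

theorem add_bracket (x y z : A) : ⁅x + y, z⁆ = ⁅x, z⁆ + ⁅y, z⁆ := by
  simp only [Ring.lie_def]; noncomm_ring

theorem lc_add (x y : A) (l : List A) : lc (x + y) l = lc x l + lc y l := by
  induction l generalizing x y with
  | nil => rfl
  | cons b l ih => simp only [lc, add_bracket, ih]

theorem lc_append (x : A) (l l' : List A) : lc x (l ++ l') = lc (lc x l) l' := by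
  induction l generalizing x with
  | nil => rfl
  | cons b l ih => exact ih _

theorem lc_mem_lowerLie {n : ℕ} {x : A} (hx : x ∈ lowerLie A n) (l : List A) :
    lc x l ∈ lowerLie A (n + l.length) := by
  induction l generalizing n x with
  | nil => exact hx
  | cons b l ih =>
    have := ih (lie_mem_lowerLie_succ hx b)
    rwa [add_assoc, add_comm 1] at this

theorem lowerLie_eq_closure (n : ℕ) :
    lowerLie A n = AddSubgroup.closure {z | ∃ a : A, ∃ l : List A, l.length = n ∧ z = lc a l} := by
  refine le_antisymm ?_ ((AddSubgroup.closure_le _).2 ?_)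
  · induction n with
    | zero => exact fun x _ => AddSubgroup.subset_closure ⟨x, [], rfl, rfl⟩
    | succ n ih =>
      refine lowerLie_succ_le fun x hx y => ?_
      have hx' := ih hx
      clear hx
      induction hx' using AddSubgroup.closure_induction with
      | mem x h =>
        obtain ⟨a, l, hl, rfl⟩ := h
        exact AddSubgroup.subset_closure ⟨a, l ++ [y], by simp [hl], by rw [lc_append]; rfl⟩
      | zero => simp [Ring.lie_def]
      | add x z _ _ hx hz => rw [add_bracket]; exact add_mem hx hz
      | neg x _ hx =>
        rw [show ⁅-x, y⁆ = -⁅x, y⁆ by simp only [Ring.lie_def]; noncomm_ring]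
        exact neg_mem hx
  · rintro _ ⟨a, l, rfl, rfl⟩
    simpa using lc_mem_lowerLie (mem_lowerLie_zero a) l

/-- Leibniz rule for iterated inner derivations, modulo an ideal containing all terms in which at
least one derivation hits the second factor. -/
theorem lc_mul_sub_mem {a b : ℕ} {p q : A} (J : Ideal A) (l : List A)
    (hp : p ∈ lowerLie A a) (hq : q ∈ lowerLie A b)
    (h : ∀ i < l.length, ∀ u ∈ lowerLie A (a + i), ∀ w ∈ lowerLie A (b + (l.length - i)),
      u * w ∈ J) :
    lc (p * q) l - lc p l * q ∈ J := by
  induction l generalizing a b p q with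
  | nil => simp [lc]
  | cons y l ih =>
    simp only [lc, List.length_cons] at h ⊢
    have e : ⁅p * q, y⁆ = ⁅p, y⁆ * q + p * ⁅q, y⁆ := by simp only [Ring.lie_def]; noncomm_ring
    have h₁ := ih (lie_mem_lowerLie_succ hp y) hq fun i hi u hu w hw =>
      h (i + 1) (by omega) u (by rwa [add_assoc, add_comm 1] at hu) w
        (by rwa [show l.length + 1 - (i + 1) = l.length - i by omega])
    have h₂ := ih hp (lie_mem_lowerLie_succ hq y) fun i hi u hu w hw =>
      h i (by omega) u hu w
        (by rwa [show b + (l.length + 1 - i) = b + 1 + (l.length - i) by omega])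
    have h₃ := h l.length (by omega) _ (lc_mem_lowerLie hp l) _
      (by simpa using lie_mem_lowerLie_succ hq y)
    rw [e, lc_add]
    have := add_mem (add_mem h₁ h₂) h₃
    convert this using 1
    abel

/-- Products of commutators: `T⁽ᵐ⁾T⁽ⁿ⁾ ⊆ T⁽ᵐ⁺ⁿ⁻²⁾`, with `m = p + 1` and `n = q + 1`. -/
theorem mul_mem_lowerIdeal_pred {p q : ℕ} {u w : A} (hu : u ∈ lowerLie A p)
    (hw : w ∈ lowerLie A q) : u * w ∈ lowerIdeal A (p + q - 1) := by
  induction p using Nat.strong_induction_on generalizing q u w with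
  | _ p ih =>
  match p, q with
  | 0, q =>
    exact Ideal.mul_mem_left _ _
      (lowerIdeal_antitone (by omega) (mem_lowerIdeal_of_mem_lowerLie hw))
  | 1, q =>
    exact Ideal.mul_mem_left _ _
      (lowerIdeal_antitone (by omega) (mem_lowerIdeal_of_mem_lowerLie hw))
  | r + 2, 0 =>
    exact mul_mem_lowerIdeal_right
      (lowerIdeal_antitone (by omega) (mem_lowerIdeal_of_mem_lowerLie hu)) _
  | r + 2, q + 1 =>
    rw [lowerLie_eq_closure] at hu
    induction hu using AddSubgroup.closure_induction with
    | zero => simp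
    | add x z _ _ hx hz => rw [add_mul]; exact add_mem hx hz
    | neg x _ hx => rw [neg_mul]; exact neg_mem hx
    | mem u h =>
    obtain ⟨a, l, hl, rfl⟩ := h
    obtain ⟨y, l, rfl⟩ := List.exists_cons_of_length_eq_add_one hl
    replace hl : l.length = r + 1 := by simpa using hl
    simp only [lc]
    have hb : ⁅a, y⁆ ∈ lowerLie A 1 := lie_mem_lowerLie_succ (mem_lowerLie_zero a) y
    generalize ⁅a, y⁆ = b at hb ⊢
    rw [show r + 2 + (q + 1) - 1 = q + r + 2 by omega]
    refine lowerLie_succ_le (B := (lowerIdeal A (q + r + 2)).toAddSubgroup.comap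
      (AddMonoidHom.mulLeft (lc b l))) ?_ hw
    intro v hv c
    change lc b l * ⁅v, c⁆ ∈ lowerIdeal A (q + r + 2)
    have e : ⁅v, b * c⁆ = b * ⁅v, c⁆ + ⁅v, b⁆ * c := by simp only [Ring.lie_def]; noncomm_ring
    have hvb : ⁅v, b⁆ ∈ lowerLie A (q + 2) := lie_mem_lowerLie hv hb
    have h₀ : lc ⁅v, b * c⁆ l ∈ lowerIdeal A (q + r + 2) := by
      have := lc_mem_lowerLie (lie_mem_lowerLie_succ hv (b * c)) l
      rw [hl] at this
      exact lowerIdeal_antitone (by omega) (mem_lowerIdeal_of_mem_lowerLie this)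
    have h₁ := lc_mul_sub_mem (lowerIdeal A (q + r + 2)) l hb (lie_mem_lowerLie_succ hv c)
      fun i hi u hu w hw => lowerIdeal_antitone (by omega) (ih (1 + i) (by omega) hu hw)
    have h₂ := lc_mul_sub_mem (lowerIdeal A (q + r + 2)) l hvb (mem_lowerLie_zero c)
      fun i hi u hu w hw => mul_mem_lowerIdeal_swap (by omega) hw hu
        (lowerIdeal_antitone (by omega) (ih (0 + (l.length - i)) (by omega) hw hu))
    have h₃ : lc ⁅v, b⁆ l * c ∈ lowerIdeal A (q + r + 2) :=
      mul_mem_lowerIdeal_right (lowerIdeal_antitone (by omega)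
        (mem_lowerIdeal_of_mem_lowerLie (lc_mem_lowerLie hvb l))) c
    rw [e, lc_add] at h₀
    have := sub_mem h₀ (add_mem (add_mem h₁ h₂) h₃)
    convert this using 1
    abel

/-- Expresses a multiple of `[a[b, c, d], e]` through commutators of length four whose entries are
products of the variables, up to a commutator of length five. -/
theorem three_mul_lie_mul_lie_lie (a b c d e : A) :
    ⁅3 * a * ⁅⁅b, c⁆, d⁆, e⁆ =
      ⁅⁅⁅b * a, d⁆, e⁆, c⁆
      - ⁅⁅⁅c, b⁆, d⁆, e * a⁆
      - ⁅⁅⁅a, d⁆, b⁆, c * e⁆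
      - ⁅⁅⁅b * d, e⁆, a⁆, c⁆
      + ⁅⁅⁅e, c⁆, a⁆, d * b⁆
      - ⁅⁅⁅d, a⁆, c⁆, e * b⁆
      - 2 • ⁅⁅⁅⁅d, a⁆, c⁆, b⁆, e⁆
      - ⁅⁅⁅b, c⁆, a⁆, d * e⁆
      - ⁅⁅⁅a * c, e⁆, d⁆, b⁆
      + ⁅⁅⁅b, e⁆, d * c⁆, a⁆
      + 3 • ⁅⁅⁅d * b, a⁆, c⁆, e⁆
      + ⁅⁅⁅a, e⁆, c * d⁆, b⁆
      - ⁅⁅⁅e, d⁆, a * b⁆, c⁆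
      - 2 • ⁅⁅⁅b, a⁆, c * d⁆, e⁆
      - 2 • ⁅⁅⁅a * c, b⁆, d⁆, e⁆
      + ⁅⁅⁅e, b⁆, d⁆, c * a⁆
      - ⁅⁅⁅e, c⁆, d⁆, b * a⁆
      + ⁅⁅⁅a, d⁆, b * c⁆, e⁆ := by
  have h3 : 3 * a = a + a + a := by noncomm_ring
  rw [h3]
  simp only [Ring.lie_def, mul_sub, sub_mul, add_mul, mul_add, ← mul_assoc]
  abel

theorem lie_mem_lowerLie_of_even {t : A} (ht : 3 * t = 1) {n : ℕ} (hn : Even n) {x : A}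
    (hx : x ∈ lowerIdeal A n) (y : A) :
    ⁅x, y⁆ ∈ lowerLie A (n + 1) := by
  obtain ⟨k, rfl⟩ := hn
  induction k generalizing x y with
  | zero => exact lie_mem_lowerLie_succ (mem_lowerLie_zero x) y
  | succ k ih =>
    rw [show k + 1 + (k + 1) = k + k + 2 by ring] at hx ⊢
    generalize k + k = n at ih hx
    have key {i : ℕ} {u X : A} (hu : u ∈ lowerLie A i) (hX : X ∈ lowerIdeal A n) :
        ⁅u, X⁆ ∈ lowerLie A (n + i + 1) := by
      rw [show ⁅u, X⁆ = -⁅X, u⁆ by simp only [Ring.lie_def]; noncomm_ring]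
      exact neg_mem (lie_mem_lowerLie_add (fun y => ih y hX) hu)
    have k₁ {X : A} (hX : X ∈ lowerIdeal A n) (y z w : A) :
        ⁅⁅⁅X, y⁆, z⁆, w⁆ ∈ lowerLie A (n + 3) :=
      lie_mem_lowerLie_succ (lie_mem_lowerLie_succ (ih y hX) z) w
    have k₂ {X : A} (hX : X ∈ lowerIdeal A n) (y z w : A) :
        ⁅⁅⁅y, X⁆, z⁆, w⁆ ∈ lowerLie A (n + 3) :=
      lie_mem_lowerLie_succ (lie_mem_lowerLie_succ (key (mem_lowerLie_zero y) hX) z) w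
    have l₂ (y z : A) : ⁅y, z⁆ ∈ lowerLie A 1 := lie_mem_lowerLie_succ (mem_lowerLie_zero y) z
    have k₃ {X : A} (hX : X ∈ lowerIdeal A n) (y z w : A) :
        ⁅⁅⁅y, z⁆, X⁆, w⁆ ∈ lowerLie A (n + 3) :=
      lie_mem_lowerLie_succ (key (l₂ y z) hX) w
    have k₄ {X : A} (hX : X ∈ lowerIdeal A n) (y z w : A) :
        ⁅⁅⁅y, z⁆, w⁆, X⁆ ∈ lowerLie A (n + 3) :=
      key (lie_mem_lowerLie_succ (l₂ y z) w) hX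
    have main (a b c d e : A) (hb : b ∈ lowerLie A n) :
        ⁅a * ⁅⁅b, c⁆, d⁆, e⁆ ∈ lowerLie A (n + 3) := by
      have hb := mem_lowerIdeal_of_mem_lowerLie hb
      have hl (z : A) : z * b ∈ lowerIdeal A n := Ideal.mul_mem_left _ z hb
      have hr (z : A) : b * z ∈ lowerIdeal A n := mul_mem_lowerIdeal_right hb z
      rw [show a = 3 * (t * a) by rw [← mul_assoc, ht, one_mul], three_mul_lie_mul_lie_lie]
      generalize t * a = a
      have s2 {z : A} (hz : z ∈ lowerLie A (n + 3)) : 2 • z ∈ lowerLie A (n + 3) :=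
        nsmul_mem hz 2
      have s3 {z : A} (hz : z ∈ lowerLie A (n + 3)) : 3 • z ∈ lowerLie A (n + 3) :=
        nsmul_mem hz 3
      repeat' first
        | with_reducible apply add_mem
        | with_reducible apply sub_mem
        | with_reducible apply s2
        | with_reducible apply s3
      exacts [k₁ (hr _) _ _ _, k₂ hb _ _ _, k₃ hb _ _ _, k₁ (hr _) _ _ _, k₄ (hl _) _ _ _,
        k₄ (hl _) _ _ _, k₃ hb _ _ _, k₁ hb _ _ _, k₄ hb _ _ _, k₁ hb _ _ _, k₁ (hl _) _ _ _,
        k₄ hb _ _ _, k₃ (hl _) _ _ _, k₁ hb _ _ _, k₂ hb _ _ _, k₂ hb _ _ _, k₄ (hr _) _ _ _,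
        k₃ (hr _) _ _ _]
    suffices ∀ a, ⁅a * x, y⁆ ∈ lowerLie A (n + 3) by simpa using this 1
    induction hx using Submodule.span_induction generalizing y with
    | zero => simp [Ring.lie_def]
    | add x z _ _ hx hz => intro a; rw [mul_add, add_bracket]; exact add_mem (hx y a) (hz y a)
    | smul b x _ hx => intro a; rw [smul_eq_mul, ← mul_assoc]; exact hx y (a * b)
    | mem x hx =>
      intro a
      let f (a y : A) : A →+ A :=
        (AddMonoidHom.mulRight y - AddMonoidHom.mulLeft y).comp (AddMonoidHom.mulLeft a)
      refine lowerLie_succ_le (B := (lowerLie A (n + 3)).comap (f a y)) ?_ hx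
      intro v hv d
      let g : A →+ A := AddMonoidHom.mulRight d - AddMonoidHom.mulLeft d
      refine lowerLie_succ_le (B := ((lowerLie A (n + 3)).comap (f a y)).comap g) ?_ hv
      exact fun b hb c => main a b c d y hb

/-- Products of commutators: `T⁽ᵐ⁾T⁽ⁿ⁾ ⊆ T⁽ᵐ⁺ⁿ⁻¹⁾` for `m` odd, with `m = p + 1` and `n = q + 1`. -/
theorem mul_mem_lowerIdeal_of_even {t : A} (ht : 3 * t = 1) {p q : ℕ} (hp : Even p) {u w : A}
    (hu : u ∈ lowerLie A p) (hw : w ∈ lowerLie A q) : u * w ∈ lowerIdeal A (p + q) := by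
  match q with
  | 0 => exact mul_mem_lowerIdeal_right (mem_lowerIdeal_of_mem_lowerLie hu) w
  | q + 1 =>
    refine lowerLie_succ_le (B := (lowerIdeal A (p + (q + 1))).toAddSubgroup.comap
      (AddMonoidHom.mulLeft u)) ?_ hw
    intro x hx y
    change u * ⁅x, y⁆ ∈ lowerIdeal A (p + q + 1)
    have e : u * ⁅x, y⁆ = ⁅u, x⁆ * y - ⁅u * y, x⁆ := by simp only [Ring.lie_def]; noncomm_ring
    rw [e]
    have huy := mul_mem_lowerIdeal_right (mem_lowerIdeal_of_mem_lowerLie hu) y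
    exact sub_mem
      (mul_mem_lowerIdeal_right (mem_lowerIdeal_of_mem_lowerLie (lie_mem_lowerLie hu hx)) y)
      (mem_lowerIdeal_of_mem_lowerLie
        (lie_mem_lowerLie_add (lie_mem_lowerLie_of_even ht hp huy) hx))

theorem prod_ofFn_mem_lowerIdeal {t : A} (ht : 3 * t = 1) {k : ℕ} (p : Fin k → ℕ) (v : Fin k → A)
    (hv : ∀ i, v i ∈ lowerIdeal A (p i)) :
    (List.ofFn v).prod ∈ lowerIdeal A (∑ i, p i - (∑ i, p i % 2 - 1)) := by
  induction k with
  | zero => exact mem_lowerIdeal_of_mem_lowerLie (mem_lowerLie_zero _)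
  | succ k ih =>
    have hrest := ih (fun i => p i.succ) (fun i => v i.succ) fun i => hv i.succ
    have hle : ∑ i : Fin k, p i.succ % 2 ≤ ∑ i : Fin k, p i.succ :=
      Finset.sum_le_sum fun i _ => Nat.mod_le _ _
    have hmod : (∑ i : Fin k, p i.succ) % 2 = (∑ i : Fin k, p i.succ % 2) % 2 :=
      Finset.sum_nat_mod _ _ _
    rw [List.ofFn_succ, List.prod_cons, Fin.sum_univ_succ, Fin.sum_univ_succ]
    generalize ∑ i : Fin k, p i.succ % 2 = e at *
    generalize ∑ i : Fin k, p i.succ = P at *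
    refine mul_mem_lowerIdeal_of_forall (fun u hu w hw => ?_) (hv 0) hrest
    rcases Nat.even_or_odd (p 0) with h0 | h0
    · have := Nat.even_iff.1 h0
      exact lowerIdeal_antitone (by omega) (mul_mem_lowerIdeal_of_even ht h0 hu hw)
    · have := Nat.odd_iff.1 h0
      rcases Nat.eq_zero_or_pos e with he | he
      · have hP : Even (P - (e - 1)) := Nat.even_iff.2 (by omega)
        exact mul_mem_lowerIdeal_swap (by omega) hw hu
          (lowerIdeal_antitone (by omega) (mul_mem_lowerIdeal_of_even ht hP hw hu))
      · exact lowerIdeal_antitone (by omega) (mul_mem_lowerIdeal_pred hu hw)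

theorem mem_Tideal_succ_iff {n : ℕ} {x : A} : x ∈ Tideal A (n + 1) ↔ x ∈ lowerIdeal A n := by
  constructor
  · intro hx
    let I : TwoSidedIdeal A := TwoSidedIdeal.mk' (lowerIdeal A n) (zero_mem _) add_mem neg_mem
      (Ideal.mul_mem_left _ _) (fun h => mul_mem_lowerIdeal_right h _)
    have hI : Tideal A (n + 1) ≤ I := by
      refine TwoSidedIdeal.span_le.2 ?_
      rintro _ ⟨l, hl, rfl⟩
      obtain ⟨a, l, rfl⟩ := List.exists_cons_of_length_eq_add_one hl
      have := lc_mem_lowerLie (mem_lowerLie_zero a) l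
      rw [show 0 + l.length = n by simpa using hl] at this
      simpa [I, lcomm] using mem_lowerIdeal_of_mem_lowerLie this
    simpa [I] using hI hx
  · intro hx
    induction hx using Submodule.span_induction with
    | mem x hx =>
      rw [SetLike.mem_coe, lowerLie_eq_closure] at hx
      induction hx using AddSubgroup.closure_induction with
      | mem x h =>
        obtain ⟨a, l, hl, rfl⟩ := h
        exact TwoSidedIdeal.subset_span ⟨a :: l, by simp [hl], rfl⟩
      | zero => exact zero_mem _
      | add x y _ _ hx hy => exact add_mem hx hy
      | neg x _ hx => exact neg_mem hx
    | zero => exact zero_mem _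
    | add x y _ _ hx hy => exact add_mem hx hy
    | smul a x _ hx => exact TwoSidedIdeal.mul_mem_left _ _ _ hx

end LowerCentralSeries

/-- If `1/6 ∈ R`, `mᵢ ≥ 2`, `ℓ < k` of the `mᵢ` are odd and `k - ℓ > 0` are even, then
`T⁽ᵐ¹⁾(A) ⋯ T⁽ᵐᵏ⁾(A) ⊆ T⁽ᴺ⁾(A)` where `N = N_{k,ℓ} = ∑ mᵢ - 2k + ℓ + 2`. -/
theorem statement_2 (R : Type*) [CommRing R] (h6 : IsUnit (6 : R))
    (A : Type*) [Ring A] [Algebra R A]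
    (k ℓ : ℕ) (hℓk : ℓ < k) (m : Fin k → ℕ) (hm : ∀ i, 2 ≤ m i)
    (S : Finset (Fin k)) (hcard : S.card = ℓ)
    (hoddS : ∀ i ∈ S, Odd (m i)) (hevenS : ∀ i ∉ S, Even (m i))
    (v : Fin k → A) (hv : ∀ i, v i ∈ Tideal A (m i)) :
    (List.ofFn v).prod ∈ Tideal A ((∑ i, m i) + ℓ + 2 - 2 * k) := by
  obtain ⟨w, hw⟩ := h6.exists_right_inv
  have ht : (3 : A) * algebraMap R A (2 * w) = 1 := by
    rw [← map_one (algebraMap R A), ← hw, ← map_ofNat (algebraMap R A) 3, ← map_mul]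
    congr 1
    ring
  have hsucc : ∀ i, m i - 1 + 1 = m i := fun i => Nat.sub_add_cancel (one_le_two.trans (hm i))
  have hprod := prod_ofFn_mem_lowerIdeal ht (fun i => m i - 1) v fun i =>
    mem_Tideal_succ_iff.1 ((hsucc i).symm ▸ hv i)
  have hsum : ∑ i, (m i - 1) + k = ∑ i, m i := by
    simpa [Finset.sum_add_distrib] using Finset.sum_congr rfl fun i (_ : i ∈ Finset.univ) => hsucc i
  have hcount : ∑ i, (m i - 1) % 2 + ℓ = k := by
    have hS : ∑ i, (if i ∈ S then 1 else 0) = ℓ := by simpa using hcard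
    rw [← hS, ← Finset.sum_add_distrib]
    have : ∀ i, (m i - 1) % 2 + (if i ∈ S then 1 else 0) = 1 := by
      intro i
      have := hm i
      split_ifs with hi
      · have := Nat.odd_iff.1 (hoddS i hi)
        omega
      · have := Nat.even_iff.1 (hevenS i hi)
        omega
    simp [this]
  have hle : ∑ i, (m i - 1) % 2 ≤ ∑ i, (m i - 1) := Finset.sum_le_sum fun i _ => Nat.mod_le _ _
  rw [← mem_Tideal_succ_iff] at hprod
  convert hprod using 2
  omega
end
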